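/- arXiv:1709.03690 — 11 statements merged into one kernel-verified Lean document; each statement's English description precedes it below -/
import Mathlib

section
/- For any two probability distributions P=(p_1,...,p_n) and Q=(q_1,...,q_n) on a common finite alphabet with q_i > 0 for all i, and any parameter ϖ > 0, the M-I divergence is non-negative: D_ϖ(P‖Q) = log(Σ_{i=1}^n p_i·exp(ϖ·p_i/q_i)) − ϖ ≥ 0. -/
/-- A linear lower bound for each summand of the M-I divergence. -/
lemma exp_mul_le_mul_exp_div {a b w : ℝ} (ha : 0 ≤ a) (hb : 0 < b) (hw : 0 < w) :
    Real.exp w * (a + w * (a - b)) ≤ a * Real.exp (w * (a / b)) := by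
  have hsq : a - b ≤ a * (a / b - 1) := by
    have h : a * (a / b - 1) - (a - b) = (a - b) ^ 2 / b := by
      field_simp
    have : 0 ≤ (a - b) ^ 2 / b := by positivity
    linarith
  have hexp : w * (a / b - 1) + 1 ≤ Real.exp (w * (a / b - 1)) := Real.add_one_le_exp _
  calc Real.exp w * (a + w * (a - b))
      ≤ Real.exp w * (a + w * (a * (a / b - 1))) := by gcongr
    _ = Real.exp w * (a * (w * (a / b - 1) + 1)) := by ring
    _ ≤ Real.exp w * (a * Real.exp (w * (a / b - 1))) := by gcongr
    _ = a * Real.exp (w * (a / b)) := by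
      rw [mul_left_comm, ← Real.exp_add]
      ring_nf

/-- Non-negativity of the M-I divergence
`D_ϖ(P‖Q) = log (∑ i, p i * exp (ϖ * p i / q i)) - ϖ` for probability
vectors `P`, `Q` with positive `Q` and parameter `ϖ > 0`. -/
theorem mi_divergence_nonneg (n : ℕ) (p q : Fin n → ℝ)
    (hp : ∀ i, 0 ≤ p i) (hpsum : ∑ i, p i = 1)
    (hq : ∀ i, 0 < q i) (hqsum : ∑ i, q i = 1)
    (ϖ : ℝ) (hϖ : 0 < ϖ) :
    Real.log (∑ i, p i * Real.exp (ϖ * (p i / q i))) - ϖ ≥ 0 := by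
  have hsum : Real.exp ϖ ≤ ∑ i, p i * Real.exp (ϖ * (p i / q i)) :=
    calc Real.exp ϖ = ∑ i, Real.exp ϖ * (p i + ϖ * (p i - q i)) := by
          rw [← Finset.mul_sum, Finset.sum_add_distrib, ← Finset.mul_sum,
            Finset.sum_sub_distrib, hpsum, hqsum]
          ring
      _ ≤ _ := Finset.sum_le_sum fun i _ => exp_mul_le_mul_exp_div (hp i) (hq i) hϖ
  exact sub_nonneg.mpr ((Real.le_log_iff_exp_le ((Real.exp_pos ϖ).trans_le hsum)).mpr hsum)
end

section
/- For probability distributions P=(p_1,...,p_n) and Q=(q_1,...,q_n) on a common finite alphabet with q_i > 0 for all i, and any ϖ > 0, the M-I divergence D_ϖ(P‖Q) equals 0 if and only if p_i = q_i for all i ∈ {1,...,n}. -/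
/-- Pointwise quadratic lower bound for the terms of the exponentially tilted sum. -/
theorem add_sq_le_mul_exp {a b ϖ : ℝ} (ha : 0 ≤ a) (hb : 0 < b) :
    a + ϖ * (a - b) + ϖ * (b * (a / b - 1) ^ 2) ≤ a * Real.exp (ϖ * (a / b) - ϖ) := by
  calc a + ϖ * (a - b) + ϖ * (b * (a / b - 1) ^ 2)
      = a * (ϖ * (a / b) - ϖ + 1) := by field_simp; ring
    _ ≤ a * Real.exp (ϖ * (a / b) - ϖ) :=
      mul_le_mul_of_nonneg_left (Real.add_one_le_exp _) ha


/-- The M-I divergence `D_ϖ(P‖Q) = log (∑ i, p i * exp (ϖ * p i / q i)) - ϖ`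
equals zero if and only if `P = Q`. -/
theorem mi_divergence_eq_zero_iff (n : ℕ) (p q : Fin n → ℝ)
    (hp : ∀ i, 0 ≤ p i) (hpsum : ∑ i, p i = 1)
    (hq : ∀ i, 0 < q i) (hqsum : ∑ i, q i = 1)
    (ϖ : ℝ) (hϖ : 0 < ϖ) :
    Real.log (∑ i, p i * Real.exp (ϖ * (p i / q i))) - ϖ = 0 ↔ ∀ i, p i = q i := by
  constructor
  · intro h
    have hS : 0 ≤ ∑ i, p i * Real.exp (ϖ * (p i / q i)) :=
      Finset.sum_nonneg fun i _ => mul_nonneg (hp i) (Real.exp_pos _).le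
    have hS_pos : 0 < ∑ i, p i * Real.exp (ϖ * (p i / q i)) := by
      refine hS.lt_of_ne fun h0 => ?_
      rw [← h0, Real.log_zero] at h
      linarith
    have hS_eq : ∑ i, p i * Real.exp (ϖ * (p i / q i)) = Real.exp ϖ := by
      rw [← Real.exp_log hS_pos, sub_eq_zero.mp h]
    have h_tilt : ∑ i, p i * Real.exp (ϖ * (p i / q i) - ϖ) = 1 := by
      simp_rw [Real.exp_sub, ← mul_div_assoc (p _) (Real.exp _)]
      rw [← Finset.sum_div, hS_eq, div_self (Real.exp_ne_zero ϖ)]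
    have h_le := Finset.sum_le_sum fun i (_ : i ∈ Finset.univ) =>
      add_sq_le_mul_exp (ϖ := ϖ) (hp i) (hq i)
    rw [h_tilt, Finset.sum_add_distrib, Finset.sum_add_distrib, ← Finset.mul_sum,
      ← Finset.mul_sum, Finset.sum_sub_distrib, hpsum, hqsum] at h_le
    have h_nonneg : ∀ i ∈ Finset.univ, 0 ≤ q i * (p i / q i - 1) ^ 2 := fun i _ =>
      mul_nonneg (hq i).le (sq_nonneg _)
    have h_zero : ∑ i, q i * (p i / q i - 1) ^ 2 = 0 :=
      le_antisymm (nonpos_of_mul_nonpos_right (by linarith) hϖ) (Finset.sum_nonneg h_nonneg)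
    intro i
    have hi := (Finset.sum_eq_zero_iff_of_nonneg h_nonneg).mp h_zero i (Finset.mem_univ i)
    have h_ratio : p i / q i - 1 = 0 :=
      pow_eq_zero_iff two_ne_zero |>.mp ((mul_eq_zero.mp hi).resolve_left (hq i).ne')
    exact (div_eq_one_iff_eq (hq i).ne').mp (sub_eq_zero.mp h_ratio)
  · intro h
    have h_sum : ∑ i, p i * Real.exp (ϖ * (p i / q i)) = Real.exp ϖ := by
      simp_rw [h, div_self (hq _).ne', mul_one]
      rw [← Finset.sum_mul, hqsum, one_mul]
    rw [h_sum, Real.log_exp, sub_self]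
end

section
/- For probability distributions P=(p_1,...,p_n) and Q=(q_1,...,q_n) on a common finite alphabet with q_i > 0 for all i, the M-I divergence is nondecreasing in its parameter: for all 0 < ϖ_1 ≤ ϖ_2, D_{ϖ_1}(P‖Q) ≤ D_{ϖ_2}(P‖Q). -/
/-- For `a ≥ 0`, `r * exp (a * r)` lies on the same side of its value at `1`
as `r` does of `1`. -/
lemma exp_mul_sub_one_le {a r : ℝ} (ha : 0 ≤ a) :
    Real.exp a * (r - 1) ≤ r * Real.exp (a * r) * (r - 1) := by
  rcases le_total 1 r with h | h
  · have h1 : Real.exp a ≤ Real.exp (a * r) := Real.exp_le_exp.2 (le_mul_of_one_le_right ha h)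
    have h2 : Real.exp a ≤ r * Real.exp (a * r) :=
      h1.trans (le_mul_of_one_le_left (Real.exp_pos _).le h)
    exact mul_le_mul_of_nonneg_right h2 (sub_nonneg.2 h)
  · have h1 : Real.exp (a * r) ≤ Real.exp a := Real.exp_le_exp.2 (mul_le_of_le_one_right ha h)
    have h2 : r * Real.exp (a * r) ≤ Real.exp a :=
      (mul_le_of_le_one_left (Real.exp_pos _).le h).trans h1
    exact mul_le_mul_of_nonpos_right h2 (sub_nonpos.2 h)

/-- A tangent-line lower bound for the increment of `r * exp (a * r) * exp (-a)` in `a`. -/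
lemma exp_sub_mul_add_le {a b r : ℝ} (ha : 0 ≤ a) (hab : a ≤ b) (hr : 0 ≤ r) :
    Real.exp (b - a) * (r * Real.exp (a * r) + (b - a) * (Real.exp a * (r - 1))) ≤
      r * Real.exp (b * r) := by
  have hb : Real.exp (b * r) =
      Real.exp (b - a) * (Real.exp (a * r) * Real.exp ((b - a) * (r - 1))) := by
    rw [← Real.exp_add, ← Real.exp_add]
    ring_nf
  have h1 := mul_le_mul_of_nonneg_left (exp_mul_sub_one_le (r := r) ha) (sub_nonneg.2 hab)
  have h2 := mul_le_mul_of_nonneg_left (Real.add_one_le_exp ((b - a) * (r - 1)))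
    (mul_nonneg hr (Real.exp_pos (a * r)).le)
  rw [hb, mul_left_comm r]
  refine mul_le_mul_of_nonneg_left ?_ (Real.exp_pos _).le
  linarith

/-- The M-I divergence `D_ϖ(P‖Q) = log (∑ i, p i * exp (ϖ * p i / q i)) - ϖ`
is nondecreasing in the parameter `ϖ` on `(0, ∞)`. -/
theorem mi_divergence_monotone (n : ℕ) (p q : Fin n → ℝ)
    (hp : ∀ i, 0 ≤ p i) (hpsum : ∑ i, p i = 1)
    (hq : ∀ i, 0 < q i) (hqsum : ∑ i, q i = 1)
    (ϖ₁ ϖ₂ : ℝ) (hϖ₁ : 0 < ϖ₁) (h12 : ϖ₁ ≤ ϖ₂) :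
    Real.log (∑ i, p i * Real.exp (ϖ₁ * (p i / q i))) - ϖ₁ ≤
      Real.log (∑ i, p i * Real.exp (ϖ₂ * (p i / q i))) - ϖ₂ := by
  have key : Real.exp (ϖ₂ - ϖ₁) * ∑ i, p i * Real.exp (ϖ₁ * (p i / q i)) ≤
      ∑ i, p i * Real.exp (ϖ₂ * (p i / q i)) := by
    calc Real.exp (ϖ₂ - ϖ₁) * ∑ i, p i * Real.exp (ϖ₁ * (p i / q i))
        = ∑ i, Real.exp (ϖ₂ - ϖ₁) * (p i * Real.exp (ϖ₁ * (p i / q i)) +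
            (ϖ₂ - ϖ₁) * (Real.exp ϖ₁ * (p i - q i))) := by
          simp only [← Finset.mul_sum, Finset.sum_add_distrib, Finset.sum_sub_distrib, hpsum,
            hqsum, sub_self, mul_zero, add_zero]
      _ ≤ ∑ i, p i * Real.exp (ϖ₂ * (p i / q i)) := by
          refine Finset.sum_le_sum fun i _ => ?_
          have hpi : q i * (p i / q i) = p i := mul_div_cancel₀ _ (hq i).ne'
          have h := mul_le_mul_of_nonneg_left
            (exp_sub_mul_add_le hϖ₁.le h12 (div_nonneg (hp i) (hq i).le)) (hq i).le
          generalize p i / q i = r at *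
          rw [← hpi]
          linarith
  have hpos : 0 < ∑ i, p i * Real.exp (ϖ₁ * (p i / q i)) := by
    refine zero_lt_one.trans_le (hpsum.symm.le.trans (Finset.sum_le_sum fun i _ => ?_))
    exact le_mul_of_one_le_right (hp i)
      (Real.one_le_exp (mul_nonneg hϖ₁.le (div_nonneg (hp i) (hq i).le)))
  have hlog := Real.log_le_log (mul_pos (Real.exp_pos _) hpos) key
  rw [Real.log_mul (Real.exp_pos _).ne' hpos.ne', Real.log_exp] at hlog
  linarith
end

section
/- For probability vectors P=(p_1,...,p_n) and Q=(q_1,...,q_n) with q_i > 0 for all i, and any ϖ > 0, one has Σ_{i=1}^n (p_i/q_i − 1)·p_i·exp(ϖ·p_i/q_i) ≥ 0. -/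
/-- For `c ≥ 0`, the sign of `x * exp (c * x) - exp c` agrees with that of `x - 1`. -/
theorem sub_one_mul_exp_le {c x : ℝ} (hc : 0 ≤ c) :
    (x - 1) * Real.exp c ≤ (x - 1) * (x * Real.exp (c * x)) := by
  rcases le_total 1 x with h | h
  · have hexp : Real.exp c ≤ Real.exp (c * x) :=
      Real.exp_le_exp.2 (le_mul_of_one_le_right hc h)
    exact mul_le_mul_of_nonneg_left
      (hexp.trans (le_mul_of_one_le_left (Real.exp_pos _).le h)) (sub_nonneg.2 h)
  · have hexp : Real.exp (c * x) ≤ Real.exp c :=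
      Real.exp_le_exp.2 (mul_le_of_le_one_right hc h)
    exact mul_le_mul_of_nonpos_left
      ((mul_le_of_le_one_left (Real.exp_pos _).le h).trans hexp) (sub_nonpos.2 h)

/-- The numerator of the derivative of the M-I divergence with respect to its
parameter is nonnegative:
`∑ i, (p i / q i - 1) * p i * exp (ϖ * p i / q i) ≥ 0`. -/
theorem mi_divergence_deriv_numerator_nonneg (n : ℕ) (p q : Fin n → ℝ)
    (hp : ∀ i, 0 ≤ p i) (hpsum : ∑ i, p i = 1)
    (hq : ∀ i, 0 < q i) (hqsum : ∑ i, q i = 1)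
    (ϖ : ℝ) (hϖ : 0 < ϖ) :
    0 ≤ ∑ i, (p i / q i - 1) * p i * Real.exp (ϖ * (p i / q i)) := by
  have hzero : ∑ i, (p i - q i) * Real.exp ϖ = 0 := by
    rw [← Finset.sum_mul, Finset.sum_sub_distrib, hpsum, hqsum, sub_self, zero_mul]
  rw [← hzero]
  refine Finset.sum_le_sum fun i _ => ?_
  have hpq : q i * (p i / q i) = p i := mul_div_cancel₀ _ (hq i).ne'
  have hle := mul_le_mul_of_nonneg_left
    (sub_one_mul_exp_le (x := p i / q i) hϖ.le) (hq i).le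
  calc (p i - q i) * Real.exp ϖ
      = q i * ((p i / q i - 1) * Real.exp ϖ) := by
        rw [← mul_assoc, mul_sub, hpq, mul_one]
    _ ≤ q i * ((p i / q i - 1) * (p i / q i * Real.exp (ϖ * (p i / q i)))) := hle
    _ = (p i / q i - 1) * (q i * (p i / q i)) * Real.exp (ϖ * (p i / q i)) := by ring
    _ = (p i / q i - 1) * p i * Real.exp (ϖ * (p i / q i)) := by rw [hpq]
end

section
/- For probability distributions P=(p_1,...,p_n) and Q=(q_1,...,q_n) on a common finite alphabet with q_i > 0 for all i, if P ≠ Q (i.e., p_i ≠ q_i for some i), then the M-I divergence D_ϖ(P‖Q) is strictly increasing in ϖ on (0,∞): for all 0 < ϖ_1 < ϖ_2, D_{ϖ_1}(P‖Q) < D_{ϖ_2}(P‖Q). -/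
theorem exp_mul_sub_one_lt_mul_exp_mul_sub_one {a x : ℝ} (ha : 0 ≤ a) (hx : 0 ≤ x) (hx1 : x ≠ 1) :
    Real.exp a * (x - 1) < x * Real.exp (a * x) * (x - 1) := by
  rcases lt_or_gt_of_ne hx1 with h | h
  · refine mul_lt_mul_of_neg_right ?_ (sub_neg.mpr h)
    calc x * Real.exp (a * x) ≤ x * Real.exp a := by
          gcongr
          exact mul_le_of_le_one_right ha h.le
      _ < Real.exp a := mul_lt_of_lt_one_left (Real.exp_pos a) h
  · refine mul_lt_mul_of_pos_right ?_ (sub_pos.mpr h)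
    calc Real.exp a ≤ Real.exp (a * x) :=
          Real.exp_le_exp.mpr (le_mul_of_one_le_right ha h.le)
      _ < x * Real.exp (a * x) := lt_mul_of_one_lt_left (Real.exp_pos _) h

theorem exp_mul_one_add_le_exp_mul (d x : ℝ) :
    Real.exp d * (1 + d * (x - 1)) ≤ Real.exp (d * x) := by
  have h : Real.exp (d * x) = Real.exp d * Real.exp (d * (x - 1)) := by
    rw [← Real.exp_add]
    ring_nf
  rw [h]
  gcongr
  linarith [Real.add_one_le_exp (d * (x - 1))]

/-- The tilted first moment `∑ p e^{a p / q} (p / q)` exceeds the normalisation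
`∑ p e^{a p / q}` when `p ≠ q`. -/
theorem sum_mul_exp_mul_sub_one_pos {ι : Type*} [Fintype ι] {p q : ι → ℝ} {a : ℝ} (ha : 0 ≤ a)
    (hp : ∀ i, 0 ≤ p i) (hq : ∀ i, 0 < q i) (hsum : ∑ i, p i = ∑ i, q i)
    (hne : ∃ i, p i ≠ q i) :
    0 < ∑ i, p i * Real.exp (a * (p i / q i)) * (p i / q i - 1) := by
  have key : ∀ i, p i ≠ q i → Real.exp a * (p i - q i) <
      p i * Real.exp (a * (p i / q i)) * (p i / q i - 1) := by
    intro i hi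
    have hqi := (hq i).ne'
    have h := mul_lt_mul_of_pos_left
      (exp_mul_sub_one_lt_mul_exp_mul_sub_one ha (div_nonneg (hp i) (hq i).le)
        (mt (div_eq_one_iff_eq hqi).mp hi)) (hq i)
    calc Real.exp a * (p i - q i) = q i * (Real.exp a * (p i / q i - 1)) := by field_simp
      _ < _ := h
      _ = q i * (p i / q i) * Real.exp (a * (p i / q i)) * (p i / q i - 1) := by ring
      _ = _ := by rw [mul_div_cancel₀ _ hqi]
  calc (0 : ℝ) = ∑ i, Real.exp a * (p i - q i) := by
        rw [← Finset.mul_sum, Finset.sum_sub_distrib, hsum, sub_self, mul_zero]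
    _ < _ := by
        obtain ⟨j, hj⟩ := hne
        refine Finset.sum_lt_sum (fun i _ => ?_) ⟨j, Finset.mem_univ j, key j hj⟩
        by_cases hi : p i = q i
        · simp [hi, div_self (hq i).ne']
        · exact (key i hi).le

/-- If `P ≠ Q`, the M-I divergence
`D_ϖ(P‖Q) = log (∑ i, p i * exp (ϖ * p i / q i)) - ϖ` is strictly increasing
in its parameter `ϖ` on `(0, ∞)`. -/
theorem mi_divergence_strictMono (n : ℕ) (p q : Fin n → ℝ)
    (hp : ∀ i, 0 ≤ p i) (hpsum : ∑ i, p i = 1)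
    (hq : ∀ i, 0 < q i) (hqsum : ∑ i, q i = 1)
    (hne : ∃ i, p i ≠ q i)
    (ϖ₁ ϖ₂ : ℝ) (hϖ₁ : 0 < ϖ₁) (h12 : ϖ₁ < ϖ₂) :
    Real.log (∑ i, p i * Real.exp (ϖ₁ * (p i / q i))) - ϖ₁ <
      Real.log (∑ i, p i * Real.exp (ϖ₂ * (p i / q i))) - ϖ₂ := by
  obtain ⟨k, -, hk⟩ : ∃ k ∈ Finset.univ, 0 < p k :=
    Finset.exists_lt_of_sum_lt (f := fun _ => (0 : ℝ)) (by simp [hpsum])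
  have hpos : 0 < ∑ i, p i * Real.exp (ϖ₁ * (p i / q i)) :=
    Finset.sum_pos' (fun i _ => mul_nonneg (hp i) (Real.exp_pos _).le)
      ⟨k, Finset.mem_univ k, mul_pos hk (Real.exp_pos _)⟩
  have hd : 0 < ϖ₂ - ϖ₁ := sub_pos.mpr h12
  have hmoment := sum_mul_exp_mul_sub_one_pos hϖ₁.le hp hq (hpsum.trans hqsum.symm) hne
  have hlt : Real.exp (ϖ₂ - ϖ₁) * ∑ i, p i * Real.exp (ϖ₁ * (p i / q i)) <
      ∑ i, p i * Real.exp (ϖ₂ * (p i / q i)) := by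
    calc _ < Real.exp (ϖ₂ - ϖ₁) * (∑ i, p i * Real.exp (ϖ₁ * (p i / q i)) +
          (ϖ₂ - ϖ₁) * ∑ i, p i * Real.exp (ϖ₁ * (p i / q i)) * (p i / q i - 1)) := by
          gcongr
          exact lt_add_of_pos_right _ (mul_pos hd hmoment)
      _ = ∑ i, p i * Real.exp (ϖ₁ * (p i / q i)) *
          (Real.exp (ϖ₂ - ϖ₁) * (1 + (ϖ₂ - ϖ₁) * (p i / q i - 1))) := by
          rw [Finset.mul_sum, ← Finset.sum_add_distrib, Finset.mul_sum]
          exact Finset.sum_congr rfl fun i _ => by ring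
      _ ≤ ∑ i, p i * Real.exp (ϖ₁ * (p i / q i)) *
          Real.exp ((ϖ₂ - ϖ₁) * (p i / q i)) :=
          Finset.sum_le_sum fun i _ => mul_le_mul_of_nonneg_left
            (exp_mul_one_add_le_exp_mul _ _) (mul_nonneg (hp i) (Real.exp_pos _).le)
      _ = _ := by
          refine Finset.sum_congr rfl fun i _ => ?_
          rw [mul_assoc, ← Real.exp_add]
          ring_nf
  have hlog := Real.log_lt_log (mul_pos (Real.exp_pos _) hpos) hlt
  rw [Real.log_mul (Real.exp_ne_zero _) hpos.ne', Real.log_exp] at hlog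
  linarith
end

section
/- For any ϖ > 0, any two pairs of probability distributions (P_0, Q_0) and (P_1, Q_1) on a common finite alphabet all of whose entries are strictly positive, and any 0 < λ < 1, the exponential of the M-I divergence is jointly convex: (1−λ)·exp(D_ϖ(P_0‖Q_0)) + λ·exp(D_ϖ(P_1‖Q_1)) ≥ exp(D_ϖ(P_λ‖Q_λ)), where P_λ = (1−λ)P_0 + λP_1 and Q_λ = (1−λ)Q_0 + λQ_1. -/
/-- Supporting-plane inequality for the perspective `(p, q) ↦ p * exp (c * (p / q))` of
`x ↦ x * exp (c * x)`. -/
theorem exp_mul_le_mul_exp_div_s5 {p q c : ℝ} (hp : 0 ≤ p) (hq : 0 < q) (hc : 0 ≤ c) (t : ℝ) :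
    Real.exp (c * t) * (p + c * t * (p - t * q)) ≤ p * Real.exp (c * (p / q)) := by
  have hexp : Real.exp (c * (p / q)) = Real.exp (c * t) * Real.exp (c * (p / q - t)) := by
    rw [← Real.exp_add]
    ring_nf
  have htangent : p * (c * (p / q - t) + 1) ≤ p * Real.exp (c * (p / q - t)) :=
    mul_le_mul_of_nonneg_left (Real.add_one_le_exp _) hp
  have hsq : p * (c * (p / q - t) + 1) - (p + c * t * (p - t * q)) = c * (q * (p / q - t) ^ 2) := by
    field_simp
    ring
  have hnonneg : 0 ≤ c * (q * (p / q - t) ^ 2) := by positivity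
  calc Real.exp (c * t) * (p + c * t * (p - t * q))
      ≤ Real.exp (c * t) * (p * Real.exp (c * (p / q - t))) :=
        mul_le_mul_of_nonneg_left (by linarith) (Real.exp_pos _).le
    _ = p * Real.exp (c * (p / q)) := by rw [hexp]; ring

/-- Joint convexity of `(p, q) ↦ p * exp (c * (p / q))` on positive pairs. -/
theorem mul_exp_div_jointly_convex {p₀ p₁ q₀ q₁ c a b : ℝ} (hp₀ : 0 ≤ p₀) (hp₁ : 0 ≤ p₁)
    (hq₀ : 0 < q₀) (hq₁ : 0 < q₁) (hc : 0 ≤ c) (ha : 0 < a) (hb : 0 < b) :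
    (a * p₀ + b * p₁) * Real.exp (c * ((a * p₀ + b * p₁) / (a * q₀ + b * q₁))) ≤
      a * (p₀ * Real.exp (c * (p₀ / q₀))) + b * (p₁ * Real.exp (c * (p₁ / q₁))) := by
  have hq : 0 < a * q₀ + b * q₁ := by positivity
  set t := (a * p₀ + b * p₁) / (a * q₀ + b * q₁) with ht
  have htq : t * (a * q₀ + b * q₁) = a * p₀ + b * p₁ := div_mul_cancel₀ _ hq.ne'
  have h₀ := mul_le_mul_of_nonneg_left (exp_mul_le_mul_exp_div_s5 hp₀ hq₀ hc t) ha.le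
  have h₁ := mul_le_mul_of_nonneg_left (exp_mul_le_mul_exp_div_s5 hp₁ hq₁ hc t) hb.le
  have hsum : a * (Real.exp (c * t) * (p₀ + c * t * (p₀ - t * q₀))) +
      b * (Real.exp (c * t) * (p₁ + c * t * (p₁ - t * q₁))) =
      (a * p₀ + b * p₁) * Real.exp (c * t) := by
    linear_combination (-(Real.exp (c * t) * (c * t))) * htq
  linarith

/-- Joint convexity of the exponential of the M-I divergence:
`(1-λ)·exp(D_ϖ(P₀‖Q₀)) + λ·exp(D_ϖ(P₁‖Q₁)) ≥ exp(D_ϖ(P_λ‖Q_λ))`,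
where `D_ϖ(P‖Q) = log (∑ i, p i * exp (ϖ * p i / q i)) - ϖ` and
`P_λ = (1-λ)P₀ + λP₁`, `Q_λ = (1-λ)Q₀ + λQ₁`. -/
theorem mi_divergence_exp_jointly_convex (n : ℕ) (p₀ p₁ q₀ q₁ : Fin n → ℝ)
    (hp₀ : ∀ i, 0 < p₀ i) (hp₀sum : ∑ i, p₀ i = 1)
    (hp₁ : ∀ i, 0 < p₁ i) (hp₁sum : ∑ i, p₁ i = 1)
    (hq₀ : ∀ i, 0 < q₀ i) (hq₀sum : ∑ i, q₀ i = 1)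
    (hq₁ : ∀ i, 0 < q₁ i) (hq₁sum : ∑ i, q₁ i = 1)
    (ϖ : ℝ) (hϖ : 0 < ϖ) (lam : ℝ) (hlam₀ : 0 < lam) (hlam₁ : lam < 1) :
    (1 - lam) * Real.exp (Real.log (∑ i, p₀ i * Real.exp (ϖ * (p₀ i / q₀ i))) - ϖ)
      + lam * Real.exp (Real.log (∑ i, p₁ i * Real.exp (ϖ * (p₁ i / q₁ i))) - ϖ)
    ≥ Real.exp (Real.log (∑ i, ((1 - lam) * p₀ i + lam * p₁ i) *
        Real.exp (ϖ * (((1 - lam) * p₀ i + lam * p₁ i) /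
          ((1 - lam) * q₀ i + lam * q₁ i)))) - ϖ) := by
  have hne : (Finset.univ : Finset (Fin n)).Nonempty := by
    by_contra h
    simp [Finset.not_nonempty_iff_eq_empty.mp h] at hp₀sum
  have hlam : 0 < 1 - lam := sub_pos.mpr hlam₁
  have hexp_log : ∀ p r : Fin n → ℝ, (∀ i, 0 < p i) →
      Real.exp (Real.log (∑ i, p i * Real.exp (r i)) - ϖ) =
        (∑ i, p i * Real.exp (r i)) * Real.exp (-ϖ) := fun p r hp => by
    rw [sub_eq_add_neg, Real.exp_add,
      Real.exp_log (Finset.sum_pos (fun i _ => mul_pos (hp i) (Real.exp_pos _)) hne)]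
  rw [hexp_log p₀ (fun i => ϖ * (p₀ i / q₀ i)) hp₀, hexp_log p₁ (fun i => ϖ * (p₁ i / q₁ i)) hp₁,
    hexp_log (fun i => (1 - lam) * p₀ i + lam * p₁ i)
      (fun i => ϖ * (((1 - lam) * p₀ i + lam * p₁ i) / ((1 - lam) * q₀ i + lam * q₁ i)))
      (fun i => add_pos (mul_pos hlam (hp₀ i)) (mul_pos hlam₀ (hp₁ i))),
    ge_iff_le, ← mul_assoc, ← mul_assoc, ← add_mul, Finset.mul_sum, Finset.mul_sum,
    ← Finset.sum_add_distrib]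
  exact mul_le_mul_of_nonneg_right
    (Finset.sum_le_sum fun i _ => mul_exp_div_jointly_convex (hp₀ i).le (hp₁ i).le
      (hq₀ i) (hq₁ i) hϖ.le hlam hlam₀) (Real.exp_pos _).le
end

section
/- For any ϖ > 0, reals a, b, c, d > 0, and 0 < λ < 1, one has (1−λ)·a·exp(ϖ·a/b) + λ·c·exp(ϖ·c/d) ≥ ((1−λ)a + λc)·exp(ϖ·((1−λ)a + λc)/((1−λ)b + λd)). -/
/-- The graph of `x ↦ x * exp (w * x)` lies above its tangent lines on the nonnegative half-line. -/
theorem tangent_le_mul_exp {w y : ℝ} (hw : 0 ≤ w) (hy : 0 ≤ y) (x : ℝ) :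
    x * Real.exp (w * x) + (1 + w * x) * Real.exp (w * x) * (y - x) ≤ y * Real.exp (w * y) := by
  have hexp : Real.exp (w * y) = Real.exp (w * x) * Real.exp (w * (y - x)) := by
    rw [← Real.exp_add]
    ring_nf
  calc x * Real.exp (w * x) + (1 + w * x) * Real.exp (w * x) * (y - x)
      = Real.exp (w * x) * (y * (w * (y - x) + 1) - w * (y - x) ^ 2) := by ring
    _ ≤ Real.exp (w * x) * (y * Real.exp (w * (y - x))) := by
        gcongr
        exact (sub_le_self _ (by positivity)).trans
          (mul_le_mul_of_nonneg_left (Real.add_one_le_exp _) hy)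
    _ = y * Real.exp (w * y) := by
        rw [hexp]
        ring

/-- Coordinatewise convexity inequality underlying the joint convexity of the
exponential of the M-I divergence. -/
theorem mi_pointwise_convexity (ϖ a b c d lam : ℝ)
    (hϖ : 0 < ϖ) (ha : 0 < a) (hb : 0 < b) (hc : 0 < c) (hd : 0 < d)
    (hlam₀ : 0 < lam) (hlam₁ : lam < 1) :
    (1 - lam) * a * Real.exp (ϖ * (a / b)) + lam * c * Real.exp (ϖ * (c / d))
      ≥ ((1 - lam) * a + lam * c) *
        Real.exp (ϖ * (((1 - lam) * a + lam * c) / ((1 - lam) * b + lam * d))) := by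
  have hp : 0 < (1 - lam) * b := mul_pos (sub_pos.2 hlam₁) hb
  have hq : 0 < lam * d := mul_pos hlam₀ hd
  set x := ((1 - lam) * a + lam * c) / ((1 - lam) * b + lam * d)
  have hA : ((1 - lam) * b + lam * d) * x = (1 - lam) * a + lam * c :=
    mul_div_cancel₀ _ (add_pos hp hq).ne'
  have hab : b * (a / b) = a := mul_div_cancel₀ a hb.ne'
  have hcd : d * (c / d) = c := mul_div_cancel₀ c hd.ne'
  have h₁ := mul_le_mul_of_nonneg_left
    (tangent_le_mul_exp hϖ.le (div_pos ha hb).le x) hp.le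
  have h₂ := mul_le_mul_of_nonneg_left
    (tangent_le_mul_exp hϖ.le (div_pos hc hd).le x) hq.le
  linear_combination h₁ + h₂
    - (1 - lam) * ((1 + ϖ * x) * Real.exp (ϖ * x) - Real.exp (ϖ * (a / b))) * hab
    - lam * ((1 + ϖ * x) * Real.exp (ϖ * x) - Real.exp (ϖ * (c / d))) * hcd
    + ϖ * x * Real.exp (ϖ * x) * hA
end

section
/- For any ϖ > 0, any two pairs of probability distributions (P_0, Q_0) and (P_1, Q_1) on a common finite alphabet all of whose entries are strictly positive, and any 0 < λ < 1: max{D_ϖ(P_0‖Q_0), D_ϖ(P_1‖Q_1)} ≥ D_ϖ(P_λ‖Q_λ), where P_λ = (1−λ)P_0 + λP_1 and Q_λ = (1−λ)Q_0 + λQ_1. -/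
/-- The tangent line inequality for `t ↦ t * exp (c * t)` on the nonnegative reals. -/
theorem mul_exp_tangent_le {c t s : ℝ} (hc : 0 ≤ c) (ht : 0 ≤ t) :
    Real.exp (c * s) * (s + (1 + c * s) * (t - s)) ≤ t * Real.exp (c * t) := by
  have hexp : Real.exp (c * t) = Real.exp (c * s) * Real.exp (c * (t - s)) := by
    rw [← Real.exp_add]; ring_nf
  have hlin : t * (c * (t - s) + 1) ≤ t * Real.exp (c * (t - s)) :=
    mul_le_mul_of_nonneg_left (Real.add_one_le_exp _) ht
  have hsq : 0 ≤ c * (t - s) ^ 2 := by positivity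
  calc Real.exp (c * s) * (s + (1 + c * s) * (t - s))
      ≤ Real.exp (c * s) * (t * Real.exp (c * (t - s))) := by
        gcongr
        nlinarith
    _ = t * Real.exp (c * t) := by rw [hexp]; ring

/-- Joint convexity of `(x, y) ↦ x * exp (c * (x / y))`, in homogeneous form. -/
theorem add_mul_exp_div_le {c x y u v : ℝ} (hc : 0 ≤ c) (hx : 0 ≤ x) (hy : 0 ≤ y)
    (hu : 0 < u) (hv : 0 < v) :
    (x + y) * Real.exp (c * ((x + y) / (u + v))) ≤
      x * Real.exp (c * (x / u)) + y * Real.exp (c * (y / v)) := by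
  set s := (x + y) / (u + v) with hs
  have hsum : s * (u + v) = x + y := div_mul_cancel₀ _ (by positivity)
  have hxu : u * (x / u) = x := mul_div_cancel₀ _ hu.ne'
  have hyv : v * (y / v) = y := mul_div_cancel₀ _ hv.ne'
  have h₁ := mul_le_mul_of_nonneg_left
    (mul_exp_tangent_le (s := s) hc (div_nonneg hx hu.le)) hu.le
  have h₂ := mul_le_mul_of_nonneg_left
    (mul_exp_tangent_le (s := s) hc (div_nonneg hy hv.le)) hv.le
  rw [← mul_assoc u (x / u), hxu] at h₁
  rw [← mul_assoc v (y / v), hyv] at h₂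
  calc (x + y) * Real.exp (c * s)
      = u * (Real.exp (c * s) * (s + (1 + c * s) * (x / u - s))) +
          v * (Real.exp (c * s) * (s + (1 + c * s) * (y / v - s))) := by
        linear_combination Real.exp (c * s) * (c * s * hsum
          - (1 + c * s) * hxu - (1 + c * s) * hyv)
    _ ≤ _ := add_le_add h₁ h₂

/-- Quasi-convexity corollary: the maximum of the M-I divergences of two pairs
dominates the M-I divergence of their convex combination. -/
theorem mi_divergence_max_ge_convex_comb (n : ℕ) (p₀ p₁ q₀ q₁ : Fin n → ℝ)
    (hp₀ : ∀ i, 0 < p₀ i) (hp₀sum : ∑ i, p₀ i = 1)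
    (hp₁ : ∀ i, 0 < p₁ i) (hp₁sum : ∑ i, p₁ i = 1)
    (hq₀ : ∀ i, 0 < q₀ i) (hq₀sum : ∑ i, q₀ i = 1)
    (hq₁ : ∀ i, 0 < q₁ i) (hq₁sum : ∑ i, q₁ i = 1)
    (ϖ : ℝ) (hϖ : 0 < ϖ) (lam : ℝ) (hlam₀ : 0 < lam) (hlam₁ : lam < 1) :
    max (Real.log (∑ i, p₀ i * Real.exp (ϖ * (p₀ i / q₀ i))) - ϖ)
        (Real.log (∑ i, p₁ i * Real.exp (ϖ * (p₁ i / q₁ i))) - ϖ)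
      ≥ Real.log (∑ i, ((1 - lam) * p₀ i + lam * p₁ i) *
          Real.exp (ϖ * (((1 - lam) * p₀ i + lam * p₁ i) /
            ((1 - lam) * q₀ i + lam * q₁ i)))) - ϖ := by
  have hne : (Finset.univ : Finset (Fin n)).Nonempty := by
    rw [Finset.nonempty_iff_ne_empty]
    intro h
    simp [h] at hp₀sum
  have hlam' : 0 < 1 - lam := sub_pos.2 hlam₁
  set A := ∑ i, p₀ i * Real.exp (ϖ * (p₀ i / q₀ i)) with hA
  set B := ∑ i, p₁ i * Real.exp (ϖ * (p₁ i / q₁ i)) with hB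
  have hApos : 0 < A := Finset.sum_pos (fun i _ => mul_pos (hp₀ i) (Real.exp_pos _)) hne
  have hBpos : 0 < B := Finset.sum_pos (fun i _ => mul_pos (hp₁ i) (Real.exp_pos _)) hne
  have hconv : ∑ i, ((1 - lam) * p₀ i + lam * p₁ i) *
      Real.exp (ϖ * (((1 - lam) * p₀ i + lam * p₁ i) /
        ((1 - lam) * q₀ i + lam * q₁ i))) ≤ (1 - lam) * A + lam * B := by
    rw [hA, hB, Finset.mul_sum, Finset.mul_sum, ← Finset.sum_add_distrib]
    refine Finset.sum_le_sum fun i _ => ?_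
    have h := add_mul_exp_div_le hϖ.le (mul_pos hlam' (hp₀ i)).le (mul_pos hlam₀ (hp₁ i)).le
      (mul_pos hlam' (hq₀ i)) (mul_pos hlam₀ (hq₁ i))
    rwa [mul_div_mul_left _ _ hlam'.ne', mul_div_mul_left _ _ hlam₀.ne', mul_assoc (1 - lam),
      mul_assoc lam] at h
  have hCpos : 0 < ∑ i, ((1 - lam) * p₀ i + lam * p₁ i) *
      Real.exp (ϖ * (((1 - lam) * p₀ i + lam * p₁ i) /
        ((1 - lam) * q₀ i + lam * q₁ i))) :=
    Finset.sum_pos (fun i _ => mul_pos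
      (add_pos (mul_pos hlam' (hp₀ i)) (mul_pos hlam₀ (hp₁ i))) (Real.exp_pos _)) hne
  rw [ge_iff_le, le_max_iff]
  rcases le_total A B with h | h
  · exact Or.inr (sub_le_sub_right (Real.log_le_log hCpos (hconv.trans (by nlinarith))) _)
  · exact Or.inl (sub_le_sub_right (Real.log_le_log hCpos (hconv.trans (by nlinarith))) _)
end

section
/- For any ϖ > 0, any probability distributions P, Q_0, Q_1 on a common finite alphabet all of whose entries are strictly positive, and any 0 < λ < 1: (1−λ)·exp(D_ϖ(P‖Q_0)) + λ·exp(D_ϖ(P‖Q_1)) ≥ exp(D_ϖ(P‖(1−λ)Q_0 + λQ_1)). -/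
/-- The map `x ↦ exp (c / x)` is convex on the positive reals for `c ≥ 0`. -/
theorem convexOn_exp_const_div {c : ℝ} (hc : 0 ≤ c) :
    ConvexOn ℝ (Set.Ioi 0) fun x : ℝ => Real.exp (c / x) := by
  have hinv : ConvexOn ℝ (Set.Ioi 0) fun x : ℝ => c / x := by
    simpa [div_eq_mul_inv] using (convexOn_zpow (𝕜 := ℝ) (-1)).smul hc
  refine ⟨convex_Ioi 0, fun x hx y hy a b ha hb hab => ?_⟩
  exact (Real.exp_le_exp.2 (hinv.2 hx hy ha hb hab)).trans
    (convexOn_exp.2 (Set.mem_univ _) (Set.mem_univ _) ha hb hab)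

/-- Convexity of the exponential of the M-I divergence in its second argument:
`(1-λ)·exp(D_ϖ(P‖Q₀)) + λ·exp(D_ϖ(P‖Q₁)) ≥ exp(D_ϖ(P‖(1-λ)Q₀+λQ₁))`. -/
theorem mi_divergence_exp_convex_second (n : ℕ) (p q₀ q₁ : Fin n → ℝ)
    (hp : ∀ i, 0 < p i) (hpsum : ∑ i, p i = 1)
    (hq₀ : ∀ i, 0 < q₀ i) (hq₀sum : ∑ i, q₀ i = 1)
    (hq₁ : ∀ i, 0 < q₁ i) (hq₁sum : ∑ i, q₁ i = 1)
    (ϖ : ℝ) (hϖ : 0 < ϖ) (lam : ℝ) (hlam₀ : 0 < lam) (hlam₁ : lam < 1) :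
    (1 - lam) * Real.exp (Real.log (∑ i, p i * Real.exp (ϖ * (p i / q₀ i))) - ϖ)
      + lam * Real.exp (Real.log (∑ i, p i * Real.exp (ϖ * (p i / q₁ i))) - ϖ)
    ≥ Real.exp (Real.log (∑ i, p i *
        Real.exp (ϖ * (p i / ((1 - lam) * q₀ i + lam * q₁ i)))) - ϖ) := by
  have hne : (Finset.univ : Finset (Fin n)).Nonempty := by
    rw [Finset.nonempty_iff_ne_empty]
    intro h
    simp [h] at hpsum
  have hexp (f : Fin n → ℝ) :
      Real.exp (Real.log (∑ i, p i * Real.exp (f i)) - ϖ)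
        = (∑ i, p i * Real.exp (f i)) / Real.exp ϖ := by
    rw [Real.exp_sub, Real.exp_log]
    exact Finset.sum_pos (fun i _ => mul_pos (hp i) (Real.exp_pos _)) hne
  rw [ge_iff_le, hexp, hexp, hexp, ← mul_div_assoc, ← mul_div_assoc, ← add_div]
  gcongr
  rw [Finset.mul_sum, Finset.mul_sum, ← Finset.sum_add_distrib]
  refine Finset.sum_le_sum fun i _ => ?_
  have h := (convexOn_exp_const_div (mul_nonneg hϖ.le (hp i).le)).2 (hq₀ i) (hq₁ i)
    (sub_nonneg.2 hlam₁.le) hlam₀.le (sub_add_cancel 1 lam)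
  simp only [smul_eq_mul, mul_div_assoc] at h
  calc
    _ ≤ p i * ((1 - lam) * Real.exp (ϖ * (p i / q₀ i)) + lam * Real.exp (ϖ * (p i / q₁ i))) :=
      mul_le_mul_of_nonneg_left h (hp i).le
    _ = _ := by ring
end

section
/- For probability distributions P=(p_1,...,p_n) and Q=(q_1,...,q_n) on a common finite alphabet with p_i > 0 and q_i > 0 for all i, and any ϖ ≥ 1, the M-I divergence dominates the Kullback–Leibler divergence: log(Σ_{i=1}^n p_i·exp(ϖ·p_i/q_i)) − ϖ ≥ Σ_{i=1}^n p_i·log(p_i/q_i). -/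
/-- For `ϖ ≥ 1`, the M-I divergence dominates the Kullback–Leibler divergence:
`log (∑ i, p i * exp (ϖ * p i / q i)) - ϖ ≥ ∑ i, p i * log (p i / q i)`. -/
theorem mi_divergence_ge_kl (n : ℕ) (p q : Fin n → ℝ)
    (hp : ∀ i, 0 < p i) (hpsum : ∑ i, p i = 1)
    (hq : ∀ i, 0 < q i) (hqsum : ∑ i, q i = 1)
    (ϖ : ℝ) (hϖ : 1 ≤ ϖ) :
    Real.log (∑ i, p i * Real.exp (ϖ * (p i / q i))) - ϖ ≥
      ∑ i, p i * Real.log (p i / q i) := by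
  have jensen : Real.exp (∑ i, p i * (ϖ * (p i / q i))) ≤
      ∑ i, p i * Real.exp (ϖ * (p i / q i)) := by
    simpa only [smul_eq_mul] using convexOn_exp.map_sum_le (t := Finset.univ) (w := p)
      (p := fun i => ϖ * (p i / q i)) (fun i _ => (hp i).le) hpsum (fun i _ => Set.mem_univ _)
  have log_ge : ϖ * ∑ i, p i * (p i / q i) ≤
      Real.log (∑ i, p i * Real.exp (ϖ * (p i / q i))) := by
    rw [Real.le_log_iff_exp_le ((Real.exp_pos _).trans_le jensen), Finset.mul_sum]
    convert jensen using 3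
    ring
  have kl_le : ∑ i, p i * Real.log (p i / q i) ≤ ∑ i, p i * (p i / q i) - 1 := by
    rw [← hpsum, ← Finset.sum_sub_distrib]
    refine Finset.sum_le_sum fun i _ => ?_
    have h := mul_le_mul_of_nonneg_left
      (Real.log_le_sub_one_of_pos (div_pos (hp i) (hq i))) (hp i).le
    linarith
  have one_le : 1 ≤ ∑ i, p i * (p i / q i) := by
    have h : ∑ i, (2 * p i - q i) ≤ ∑ i, p i * (p i / q i) := by
      refine Finset.sum_le_sum fun i _ => ?_
      rw [← mul_div_assoc, le_div_iff₀ (hq i)]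
      nlinarith [sq_nonneg (p i - q i)]
    rw [Finset.sum_sub_distrib, ← Finset.mul_sum, hpsum, hqsum] at h
    linarith
  nlinarith [mul_nonneg (sub_nonneg.2 hϖ) (sub_nonneg.2 one_le)]
end

section
/- For probability distributions P=(p_1,...,p_n) and Q=(q_1,...,q_n) on a common finite alphabet with p_i > 0 and q_i > 0 for all i, any ϖ ≥ 1, and any α ∈ (0,1): D_ϖ(P‖Q) ≥ D(P‖Q) ≥ D_α(P‖Q), i.e., log(Σ_i p_i·exp(ϖ·p_i/q_i)) − ϖ ≥ Σ_i p_i·log(p_i/q_i) ≥ (1/(α−1))·log(Σ_i p_i^α·q_i^{1−α}). -/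
/-- Jensen's inequality for the logarithm and finitely many positive reals. -/
theorem sum_mul_log_le_log_sum_mul {ι : Type*} (s : Finset ι) (w x : ι → ℝ)
    (hw : ∀ i ∈ s, 0 ≤ w i) (hsum : ∑ i ∈ s, w i = 1) (hx : ∀ i ∈ s, 0 < x i) :
    ∑ i ∈ s, w i * Real.log (x i) ≤ Real.log (∑ i ∈ s, w i * x i) := by
  simpa using strictConcaveOn_log_Ioi.concaveOn.le_map_sum hw hsum hx

/-- The Pearson `χ²`-divergence is nonnegative. -/
theorem one_le_sum_mul_div {ι : Type*} (s : Finset ι) (p q : ι → ℝ)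
    (hq : ∀ i ∈ s, 0 < q i) (hpsum : ∑ i ∈ s, p i = 1) (hqsum : ∑ i ∈ s, q i = 1) :
    1 ≤ ∑ i ∈ s, p i * (p i / q i) := by
  have h : ∑ i ∈ s, (2 * p i - q i) ≤ ∑ i ∈ s, p i * (p i / q i) := by
    refine Finset.sum_le_sum fun i hi => ?_
    rw [← mul_div_assoc, le_div_iff₀ (hq i hi)]
    nlinarith [sq_nonneg (p i - q i)]
  rw [Finset.sum_sub_distrib, ← Finset.mul_sum, hpsum, hqsum] at h
  linarith

/-- Chain of inequalities between the M-I divergence (`ϖ ≥ 1`), the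
Kullback–Leibler divergence, and the Rényi divergence of order `α ∈ (0,1)`:
`D_ϖ(P‖Q) ≥ D(P‖Q) ≥ D_α(P‖Q)`. -/
theorem mi_ge_kl_ge_renyi (n : ℕ) (p q : Fin n → ℝ)
    (hp : ∀ i, 0 < p i) (hpsum : ∑ i, p i = 1)
    (hq : ∀ i, 0 < q i) (hqsum : ∑ i, q i = 1)
    (ϖ : ℝ) (hϖ : 1 ≤ ϖ) (α : ℝ) (hα₀ : 0 < α) (hα₁ : α < 1) :
    Real.log (∑ i, p i * Real.exp (ϖ * (p i / q i))) - ϖ ≥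
      ∑ i, p i * Real.log (p i / q i) ∧
    ∑ i, p i * Real.log (p i / q i) ≥
      (1 / (α - 1)) * Real.log (∑ i, p i ^ α * q i ^ (1 - α)) := by
  have hr (i : Fin n) : 0 < p i / q i := div_pos (hp i) (hq i)
  constructor
  · have hjensen := sum_mul_log_le_log_sum_mul Finset.univ p
      (fun i => Real.exp (ϖ * (p i / q i))) (fun i _ => (hp i).le) hpsum
      (fun i _ => Real.exp_pos _)
    simp only [Real.log_exp, mul_left_comm _ ϖ, ← Finset.mul_sum] at hjensen
    have hchi := one_le_sum_mul_div Finset.univ p q (fun i _ => hq i) hpsum hqsum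
    have hlog : ∑ i, p i * Real.log (p i / q i) ≤ ∑ i, (p i * (p i / q i) - p i) := by
      refine Finset.sum_le_sum fun i _ => ?_
      nlinarith [Real.log_le_sub_one_of_pos (hr i), hp i]
    rw [Finset.sum_sub_distrib, hpsum] at hlog
    nlinarith
  · have hjensen := sum_mul_log_le_log_sum_mul Finset.univ p
      (fun i => (p i / q i) ^ (α - 1)) (fun i _ => (hp i).le) hpsum
      (fun i _ => Real.rpow_pos_of_pos (hr i) _)
    have hterm (i : Fin n) : p i * (p i / q i) ^ (α - 1) = p i ^ α * q i ^ (1 - α) := by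
      rw [Real.div_rpow (hp i).le (hq i).le, Real.rpow_sub_one (hp i).ne', ← neg_sub α 1,
        Real.rpow_neg (hq i).le]
      field_simp [(hp i).ne']
    simp only [hterm, Real.log_rpow (hr _), mul_left_comm _ (α - 1), ← Finset.mul_sum] at hjensen
    rw [ge_iff_le, one_div_mul_eq_div, div_le_iff_of_neg (sub_neg.mpr hα₁), mul_comm]
    exact hjensen
end
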